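/- For every integer s ≥ 1, the sum of the first s terms of the sequence ξ satisfies the lower bound s·log₂(s) − 2s ≤ ∑_{i=1}^{s} ξ_i. -/

import Mathlib

/-- The sequence ξ_i = i XOR (i-1), for positive integers i. -/
def xi (i : ℕ) : ℕ := i ^^^ (i - 1)

theorem xi_two_mul_add_one (m : ℕ) : xi (2 * m + 1) = 1 := by
  have h := Nat.xor_bit true m false m
  simpa [xi, Nat.bit_val] using h

theorem xi_two_mul_add_two (m : ℕ) : xi (2 * m + 2) = 2 * xi (m + 1) + 1 := by
  have h := Nat.xor_bit false (m + 1) true m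
  simpa [xi, Nat.bit_val, mul_add] using h

theorem sum_xi_two_mul (m : ℕ) :
    ∑ i ∈ Finset.Icc 1 (2 * m), xi i = 2 * m + 2 * ∑ i ∈ Finset.Icc 1 m, xi i := by
  induction m with
  | zero => simp
  | succ k ih =>
    rw [show 2 * (k + 1) = 2 * k + 1 + 1 by ring, Finset.sum_Icc_succ_top (by omega),
      Finset.sum_Icc_succ_top (by omega), Finset.sum_Icc_succ_top (by omega), ih,
      xi_two_mul_add_one, xi_two_mul_add_two]
    ring

theorem sum_xi_eq_add_two_mul_sum_half (s : ℕ) :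
    ∑ i ∈ Finset.Icc 1 s, xi i = s + 2 * ∑ i ∈ Finset.Icc 1 (s / 2), xi i := by
  obtain ⟨m, rfl | rfl⟩ := Nat.even_or_odd' s
  · rw [sum_xi_two_mul, Nat.mul_div_cancel_left m two_pos]
  · rw [Finset.sum_Icc_succ_top (by omega), sum_xi_two_mul, xi_two_mul_add_one,
      show (2 * m + 1) / 2 = m by omega]
    ring

theorem mul_succ_add_one_le_sum_xi_add_two_pow (n s : ℕ) :
    n * (s + 1) + 1 ≤ ∑ i ∈ Finset.Icc 1 s, xi i + 2 ^ n := by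
  induction n generalizing s with
  | zero => simp
  | succ n ih =>
    have half : n * (s + 1) ≤ n * (2 * (s / 2 + 1)) := Nat.mul_le_mul_left n (by omega)
    rw [sum_xi_eq_add_two_mul_sum_half, pow_succ]
    linarith [ih (s / 2)]

/-- For every integer `s ≥ 1`, the sum of the first `s` terms of the sequence `ξ`
satisfies `s·log₂ s − 2s ≤ ∑_{i=1}^{s} ξ_i`. -/
theorem xi_sum_lower_bound (s : ℕ) (hs : 1 ≤ s) :
    s * Real.logb 2 s - 2 * s ≤ ((∑ i ∈ Finset.Icc 1 s, xi i : ℕ) : ℝ) := by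
  have hpos : (0 : ℝ) < s := by exact_mod_cast hs
  have hlog : Real.logb 2 s ≤ (Nat.log 2 s + 1 : ℕ) := by
    rw [Real.logb_le_iff_le_rpow one_lt_two hpos, Real.rpow_natCast]
    exact_mod_cast (Nat.lt_pow_succ_log_self one_lt_two s).le
  have hpow : 2 ^ (Nat.log 2 s + 1) ≤ 2 * s := by
    rw [pow_succ']
    exact Nat.mul_le_mul_left 2 (Nat.pow_log_le_self 2 (by omega))
  have hsum : s * (Nat.log 2 s + 1) ≤ ∑ i ∈ Finset.Icc 1 s, xi i + 2 * s := by
    linarith [mul_succ_add_one_le_sum_xi_add_two_pow (Nat.log 2 s + 1) s]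
  have hsum' : (s : ℝ) * (Nat.log 2 s + 1 : ℕ) ≤ (∑ i ∈ Finset.Icc 1 s, xi i : ℕ) + 2 * s := by
    exact_mod_cast hsum
  linarith [mul_le_mul_of_nonneg_left hlog hpos.le]
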